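/- (Many Subcontainers, third subcontainer above the center) Let s₁, h₁, h₂, h₃, h′, Δy be reals with s₁ ≥ h₁ ≥ h₂ ≥ h₃ ≥ h′ > 0, 0.295 ≤ s₁ < √(8/5), T⁻¹(s₁) − h₁ − h₂ − h₃ > 0, 0 ≤ Δy ≤ h₃, and h′ ≤ 1 − Δy. Set w₁ := w(T⁻¹(s₁), h₁), w₂ := w(T⁻¹(s₁) − h₁, h₂), H_R := T⁻¹(s₁) − h₁ − h₂ + Δy, W_R := w(T⁻¹(s₁) − h₁ − h₂, H_R), and H := 1 − Δy. Then F_{MSC₂} := s₁² + 0.83·σ(s₁)² + B₄(T⁻¹(s₁), h₁, w₁, h₂) + B₄(T⁻¹(s₁) − h₁, h₂, w₂, h₃) + B₆(H_R, W_R, h′) + B₅(h′, H) > 8/5. -/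

import Mathlib

noncomputable section

/-- T⁻¹(s) = √(1 − s²/4) − s. -/
def Tinv (s : ℝ) : ℝ := Real.sqrt (1 - s ^ 2 / 4) - s

/-- T(u) = (2/5)(√(5 − u²) − 2u). -/
def Tfun (u : ℝ) : ℝ := 2 / 5 * (Real.sqrt (5 - u ^ 2) - 2 * u)

/-- s₁* = √((2 + √2)/3). -/
def s1star : ℝ := Real.sqrt ((2 + Real.sqrt 2) / 3)

/-- σ(s₁), the side length of the largest square fitting into a side pocket. -/
def sigma (s₁ : ℝ) : ℝ :=
  if s₁ ≤ s1star then
    1 / 4 * (-s₁ - 2 * Tinv s₁ + Real.sqrt (8 - (s₁ - 2 * Tinv s₁) ^ 2))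
  else
    1 / 5 * (Real.sqrt (20 - s₁ ^ 2) - 2 * s₁)

/-- w(y_t, h) = 2√(min{1 − y_t², 1 − (y_t − h)²}). -/
def wfun (yt h : ℝ) : ℝ := 2 * Real.sqrt (min (1 - yt ^ 2) (1 - (yt - h) ^ 2))

/-- X(a, b, u). -/
def Xfun (a b u : ℝ) : ℝ :=
  if u ≤ 2 * min a (-b) then Tinv u else Real.sqrt (1 - (u - min a (-b)) ^ 2) - u

/-- Y(a, h, w, h′) = w/2 − h + X(a, a − h, h′). -/
def Yfun (a h w h' : ℝ) : ℝ := w / 2 - h + Xfun a (a - h) h'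

/-- B₁(h, w, h′). -/
def B1 (h w h' : ℝ) : ℝ :=
  max (h * w / 2 + h ^ 2 / 4) (max (h ^ 2 + (w - h - h') * h') (h * (w + h) / 2 - h' ^ 2))

/-- B₂(h, w, h′). -/
def B2 (h w h' : ℝ) : ℝ :=
  if w < h + h' then h ^ 2
  else if w < 2 * h then h ^ 2 + h' ^ 2
  else B1 h w h'

/-- B₃(a, h, w, h′). -/
def B3 (a h w h' : ℝ) : ℝ :=
  max (h ^ 2 + max (Yfun a h w h') 0 * h')
      (h ^ 2 + min (max (Yfun a h w h') 0 ^ 2) (2 * h' ^ 2))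

/-- B₄(a, h, w, h′). -/
def B4 (a h w h' : ℝ) : ℝ := max (B2 h w h') (B3 a h w h')

/-- E(s₁, sₙ). -/
def Efun (s₁ sn : ℝ) : ℝ := if sn ≤ sigma s₁ then 0.83 * sigma s₁ ^ 2 else 0

/-- A(δ), the area of a circular segment of the unit disk of height δ. -/
def Aseg (δ : ℝ) : ℝ := Real.arccos (1 - δ) - (1 - δ) * Real.sqrt (1 - (1 - δ) ^ 2)

/-- B₅(h, H) = A(H − h) + h² − H·h. -/
def B5 (h H : ℝ) : ℝ := Aseg (H - h) + h ^ 2 - H * h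

/-- B₆(H_R, W_R, h′) = H_R·W_R/2 + h′·H_R/4. -/
def B6 (HR WR h' : ℝ) : ℝ := HR * WR / 2 + h' * HR / 4

/-- Chord bound for the half-width of the unit disk at height `y`. -/
lemma chord_le_wfun {y h : ℝ} (hy : 0 ≤ y) (hy' : y ≤ 0.6945) (hh : 0 ≤ h) (hh' : h ≤ 2 * y) :
    2 * (1 - 0.404 * y) ≤ wfun y h := by
  unfold wfun
  gcongr
  apply Real.le_sqrt_of_sq_le
  have hsq : (1 - 0.404 * y) ^ 2 ≤ 1 - y ^ 2 := by nlinarith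
  exact le_min hsq (by nlinarith)

lemma arcsin_add_mul_sqrt_le {x : ℝ} (hx : 0 ≤ x) (hx' : x ≤ 1) :
    Real.arcsin x + x * Real.sqrt (1 - x ^ 2) ≤ 2 * x := by
  have hmono : MonotoneOn (fun θ : ℝ => 2 * Real.sin θ - (θ + Real.sin θ * Real.cos θ))
      (Set.Icc 0 (Real.pi / 2)) := by
    refine monotoneOn_of_hasDerivWithinAt_nonneg
      (f' := fun θ => 2 * Real.cos θ - (1 + (Real.cos θ * Real.cos θ + Real.sin θ * -Real.sin θ)))
      (convex_Icc _ _) (by fun_prop) (fun θ _ => ?_) (fun θ hθ => ?_)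
    · exact (((Real.hasDerivAt_sin θ).const_mul 2).sub ((hasDerivAt_id θ).add
        ((Real.hasDerivAt_sin θ).mul (Real.hasDerivAt_cos θ)))).hasDerivWithinAt
    · rw [interior_Icc] at hθ
      have hcos : 0 ≤ Real.cos θ :=
        Real.cos_nonneg_of_mem_Icc ⟨by linarith [hθ.1, Real.pi_pos], hθ.2.le⟩
      nlinarith [Real.sin_sq_add_cos_sq θ, Real.cos_le_one θ]
  have hπ : (0 : ℝ) ≤ Real.pi / 2 := by positivity
  have h := hmono ⟨le_rfl, hπ⟩ ⟨Real.arcsin_nonneg.2 hx, Real.arcsin_le_pi_div_two x⟩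
    (Real.arcsin_nonneg.2 hx)
  simp only [Real.sin_zero, Real.sin_arcsin (by linarith) hx', Real.cos_arcsin] at h
  linarith

/-- The segment area is at least its tangent line at the half disk. -/
lemma half_disk_tangent_le_Aseg {x : ℝ} (hx : 0 ≤ x) (hx' : x ≤ 1) :
    Real.pi / 2 - 2 * x ≤ Aseg (1 - x) := by
  have h := arcsin_add_mul_sqrt_le hx hx'
  unfold Aseg
  rw [sub_sub_cancel, Real.arccos]
  linarith

lemma le_B4 {a h w h' : ℝ} (h0 : h' ≤ h) (hw : 2 * h ≤ w) :
    h ^ 2 + (w - h - h') * h' ≤ B4 a h w h' := by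
  refine le_trans ?_ (le_max_left _ _)
  rw [B2, if_neg (by linarith), if_neg (by linarith), B1]
  exact (le_max_left _ _).trans (le_max_right _ _)

lemma Tinv_le {s : ℝ} (hs : 0.295 ≤ s) : Tinv s ≤ 0.6945 := by
  have h : Real.sqrt (1 - s ^ 2 / 4) ≤ 0.9895 := by
    apply Real.sqrt_le_iff.2
    constructor <;> nlinarith
  unfold Tinv
  linarith

lemma quadratic_lower_bound {a b c r : ℝ} (hc : 0 ≤ c) (hcb : c ≤ b) (hba : b ≤ a) (hcr : c ≤ r)
    (hsum : a + b + r ≤ 0.6945) :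
    1.6 < 0.295 ^ 2 + 1.57 + a ^ 2 + (2 * (1 - 0.404 * (a + b + r)) - a - b) * b +
      b ^ 2 + (2 * (1 - 0.404 * (b + r)) - b - c) * c +
      (r + c) * (1 - 0.404 * r + c / 4) - 5 * c + 2 * c ^ 2 := by
  obtain ⟨u, rfl⟩ : ∃ u, b = c + u := ⟨b - c, by ring⟩
  obtain ⟨p, rfl⟩ : ∃ p, a = c + u + p := ⟨a - (c + u), by ring⟩
  obtain ⟨v, rfl⟩ : ∃ v, r = c + v := ⟨r - c, by ring⟩
  have hu : 0 ≤ u := by linarith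
  have hp : 0 ≤ p := by linarith
  have hv : 0 ≤ v := by linarith
  have he : 0 ≤ 0.6945 - 3 * c - 2 * u - p - v := by linarith
  nlinarith [mul_nonneg hc he, mul_nonneg hu he, mul_nonneg hp he, mul_nonneg hv he,
    mul_nonneg hc hu, mul_nonneg hc hp, mul_nonneg hc hv, mul_nonneg hu hp, mul_nonneg hu hv,
    mul_nonneg hp hv, sq_nonneg p, sq_nonneg u, sq_nonneg v, sq_nonneg c]

/-- The part of the bound involving the two innermost parameters is smallest when both equal `c`. -/
lemma innermost_lower_bound {c r d k : ℝ} (hkc : k ≤ c) (hdc : d ≤ c)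
    (hcr : c ≤ r) (hc : 3 * c ≤ 0.6945) (hr : r ≤ 0.6945) :
    (r + c) * (1 - 0.404 * r + c / 4) - 5 * c + 2 * c ^ 2 ≤
      (r + d) * (1 - 0.404 * r + k / 4) - 2 * (d + k) + k ^ 2 - (1 - d) * k := by
  have h1 : 0 ≤ (c - d) * (2 - (1 - 0.404 * r + k / 4) - k) :=
    mul_nonneg (by linarith) (by linarith)
  have h2 : 0 ≤ (c - k) * (3 - c - (r + c) / 4 - (c + k)) :=
    mul_nonneg (by linarith) (by linarith)
  nlinarith

theorem many_subcontainers_above_center (s₁ h₁ h₂ h₃ h' Δy : ℝ)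
    (hpos : 0 < h') (hp3 : h' ≤ h₃) (h32 : h₃ ≤ h₂) (h21 : h₂ ≤ h₁) (h1s : h₁ ≤ s₁)
    (hs1lo : 0.295 ≤ s₁) (hs1hi : s₁ < Real.sqrt (8 / 5))
    (habove : 0 < Tinv s₁ - h₁ - h₂ - h₃)
    (hΔ0 : 0 ≤ Δy) (hΔ3 : Δy ≤ h₃) (hpH : h' ≤ 1 - Δy) :
    s₁ ^ 2 + 0.83 * sigma s₁ ^ 2 +
      B4 (Tinv s₁) h₁ (wfun (Tinv s₁) h₁) h₂ +
      B4 (Tinv s₁ - h₁) h₂ (wfun (Tinv s₁ - h₁) h₂) h₃ +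
      B6 (Tinv s₁ - h₁ - h₂ + Δy)
         (wfun (Tinv s₁ - h₁ - h₂) (Tinv s₁ - h₁ - h₂ + Δy)) h' +
      B5 h' (1 - Δy) > 8 / 5 := by
  have h3 : 0 < h₃ := hpos.trans_le hp3
  have h2 : 0 < h₂ := h3.trans_le h32
  have h1 : 0 < h₁ := h2.trans_le h21
  have hT := Tinv_le hs1lo
  set t := Tinv s₁
  set r := t - h₁ - h₂ with hr
  have hw1 := chord_le_wfun (y := t) (h := h₁) (by linarith) hT h1.le (by linarith)
  have hw2 := chord_le_wfun (y := t - h₁) (h := h₂) (by linarith) (by linarith) h2.le (by linarith)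
  have hw3 := chord_le_wfun (y := r) (h := r + Δy) (by linarith) (by linarith) (by linarith)
    (by linarith)
  have hB1 := le_B4 (a := t) h21 (w := wfun t h₁) (by linarith)
  have hB2 := le_B4 (a := t - h₁) h32 (w := wfun (t - h₁) h₂) (by linarith)
  have hA := half_disk_tangent_le_Aseg (x := Δy + h') (by linarith) (by linarith)
  have hmono1 := mul_le_mul_of_nonneg_right hw1 h2.le
  have hmono2 := mul_le_mul_of_nonneg_right hw2 h3.le
  have hmono3 := mul_le_mul_of_nonneg_left hw3 (show 0 ≤ r + Δy by linarith)
  have hinner := innermost_lower_bound (r := r) hp3 hΔ3 (by linarith) (by linarith)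
    (by linarith)
  have hquad := quadratic_lower_bound (r := r) h3.le h32 h21 (by linarith) (by linarith)
  have hσ : 0 ≤ 0.83 * sigma s₁ ^ 2 := by positivity
  have hs : (0.295 : ℝ) ^ 2 ≤ s₁ ^ 2 := by gcongr
  have hπ := Real.pi_gt_d2
  rw [show h₁ + h₂ + r = t by rw [hr]; ring, show h₂ + r = t - h₁ by rw [hr]; ring] at hquad
  have hB5 : B5 h' (1 - Δy) = Aseg (1 - (Δy + h')) + h' ^ 2 - (1 - Δy) * h' := by
    rw [B5, sub_sub]
  rw [hB5, B6]
  linarith
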